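/- arXiv:2004.02239 — 2 statements merged into one kernel-verified Lean document; each statement's English description precedes it below -/
import Mathlib

section
/- For λ₁ ≠ λ₂ in ℝ \ {0,1}, the 2-parameter persistence modules M₁ and M₂ defined by the Carlsson–Zomorodian construction (with ℝ² at (0,0),(1,0),(0,1),(2,0),(1,1),(0,2); ℝ at (3,0),(2,1),(1,2),(0,3); identity maps among the ℝ² spaces; maps a(x,y)=x, b(x,y)=y, c(x,y)=x+y into three of the rank-1 spots and d_i(x,y)=x+λ_i·y into the fourth; and 0 elsewhere) are not isomorphic. -/
/-- `a(x,y) = x`, landing in the rank-1 spot (embedded as the `x`-axis of `ℝ²`). -/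
def czA : (ℝ × ℝ) →ₗ[ℝ] (ℝ × ℝ) where
  toFun v := (v.1, 0)
  map_add' v w := by simp
  map_smul' c v := by simp

/-- `b(x,y) = y`. -/
def czB : (ℝ × ℝ) →ₗ[ℝ] (ℝ × ℝ) where
  toFun v := (v.2, 0)
  map_add' v w := by simp
  map_smul' c v := by simp

/-- `c(x,y) = x + y`. -/
def czC : (ℝ × ℝ) →ₗ[ℝ] (ℝ × ℝ) where
  toFun v := (v.1 + v.2, 0)
  map_add' v w := by simp; ring
  map_smul' c v := by simp; ring

/-- `d(x,y) = x + λ·y`. -/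
def czD (l : ℝ) : (ℝ × ℝ) →ₗ[ℝ] (ℝ × ℝ) where
  toFun v := (v.1 + l * v.2, 0)
  map_add' v w := by simp; ring
  map_smul' c v := by simp; ring

/-- The graded pieces of the Carlsson–Zomorodian module, realized as subspaces of a fixed
ambient `ℝ²`: all of `ℝ²` in total degree `≤ 2`, a line (the `x`-axis, a copy of `ℝ`) in
total degree `3`, and `0` in higher degrees. -/
def czSpace (α : ℕ × ℕ) : Submodule ℝ (ℝ × ℝ) :=
  if α.1 + α.2 ≤ 2 then ⊤
  else if α.1 + α.2 = 3 then LinearMap.ker (LinearMap.snd ℝ ℝ ℝ)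
  else ⊥

/-- The structure map `M_α → M_β` of the Carlsson–Zomorodian module with parameter `l`,
written as a map of the ambient `ℝ²`: identities among the rank-2 spots, the maps
`a`, `b`, `c`, `d_l` into the four rank-1 spots `(0,3)`, `(2,1)`, `(1,2)`, `(3,0)`, and
`0` beyond total degree `3`. -/
def czMap (l : ℝ) (α β : ℕ × ℕ) : (ℝ × ℝ) →ₗ[ℝ] (ℝ × ℝ) :=
  if α = β then LinearMap.id
  else if β.1 + β.2 ≤ 2 then LinearMap.id
  else if β.1 + β.2 = 3 then
    (if β = (3, 0) then czD l else if β = (0, 3) then czA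
      else if β = (2, 1) then czB else czC)
  else 0

/-- For `λ₁ ≠ λ₂` in `ℝ \ {0,1}`, the two Carlsson–Zomorodian 2-parameter
persistence modules `M₁`, `M₂` (same graded pieces `czSpace`, structure maps `czMap l₁`
resp. `czMap l₂`) are not isomorphic: there is no grade-wise family of linear maps of the
ambient `ℝ²` restricting to isomorphisms `M₁_α → M₂_α` and commuting with all structure
maps. -/
theorem carlsson_zomorodian_not_isomorphic (l₁ l₂ : ℝ)
    (h₁0 : l₁ ≠ 0) (h₁1 : l₁ ≠ 1) (h₂0 : l₂ ≠ 0) (h₂1 : l₂ ≠ 1) (hne : l₁ ≠ l₂) :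
    ¬ ∃ Γ : (α : ℕ × ℕ) → (ℝ × ℝ) →ₗ[ℝ] (ℝ × ℝ),
        (∀ α, (czSpace α).map (Γ α) = czSpace α) ∧
        (∀ α, ∀ v ∈ czSpace α, Γ α v = 0 → v = 0) ∧
        (∀ α β : ℕ × ℕ, α ≤ β → ∀ v ∈ czSpace α,
          Γ β (czMap l₁ α β v) = czMap l₂ α β (Γ α v)) := by
  rintro ⟨Γ, -, hinj, hcomm⟩
  have hmem (v : ℝ × ℝ) : v ∈ czSpace (0, 0) := by simp [czSpace]
  have key (β : ℕ × ℕ) (v : ℝ × ℝ) (hv : czMap l₁ (0, 0) β v = 0) :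
      czMap l₂ (0, 0) β (Γ (0, 0) v) = 0 := by
    rw [← hcomm (0, 0) β (by simp [Prod.le_def]) v (hmem v), hv, map_zero]
  have hlin (x y : ℝ) : Γ (0, 0) (x, y) = x • Γ (0, 0) (1, 0) + y • Γ (0, 0) (0, 1) := by
    rw [← map_smul, ← map_smul, ← map_add]
    simp
  have hA : (Γ (0, 0) (0, 1)).1 = 0 := by
    simpa [czMap, czA] using key (0, 3) (0, 1) (by simp [czMap, czA])
  have hB : (Γ (0, 0) (1, 0)).2 = 0 := by
    simpa [czMap, czB] using key (2, 1) (1, 0) (by simp [czMap, czB])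
  have hC := key (1, 2) (1, -1) (by simp [czMap, czC])
  have hD := key (3, 0) (-l₁, 1) (by simp [czMap, czD])
  rw [hlin] at hC hD
  simp [czMap, czC] at hC
  simp [czMap, czD] at hD
  have hp : (l₂ - l₁) * (Γ (0, 0) (1, 0)).1 = 0 := by
    linear_combination hD + l₂ * hC + (l₂ - 1) * hA + (l₂ * l₁ - l₂) * hB
  have hp0 := (mul_eq_zero.mp hp).resolve_left (sub_ne_zero.mpr hne.symm)
  simpa using hinj (0, 0) (1, 0) (hmem _) (Prod.ext hp0 hB)
end

section
/- Let M be a finitely presented 2-parameter persistence module with minimal free resolution 0 → F₂ → F₁ → F₀ → M → 0, and let m_{j,α} denote the multiplicity of α in ξ_j(M) (the number of free generators of F_j in degree α). For α ∈ ℕ², let z_α denote dim{w ∈ M_α : ᴹφ_α^{α+e₁}(w) = 0 and ᴹφ_α^{α+e₂}(w) = 0}. Then m_{1,α+e₁+e₂} = m_{0,α+e₁+e₂} − dim(M_{α+e₁+e₂}) + dim(M_{α+e₁}) + dim(M_{α+e₂}) − dim(M_α) + z_α. -/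
/-- The free 2-parameter persistence module on a finite (multi)set of generators,
indexed by `ι` with degrees `deg`: at grade `α` it is the direct sum of one copy of `F`
for each generator `i` with `deg i ≤ α` (product order on `ℕ × ℕ`). -/
abbrev FreeMod (F : Type*) [Field F] (ι : Type*) (deg : ι → ℕ × ℕ) (α : ℕ × ℕ) : Type _ :=
  {i : ι // deg i ≤ α} → F

/-- Structure map of the free module: identity on each summand present at the source,
new summands get `0`. -/
def freeMap (F : Type*) [Field F] (ι : Type*) (deg : ι → ℕ × ℕ) (α β : ℕ × ℕ)
    (_h : α ≤ β) : FreeMod F ι deg α →ₗ[F] FreeMod F ι deg β where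
  toFun f i := if h' : deg i.1 ≤ α then f ⟨i.1, h'⟩ else 0
  map_add' f g := by funext i; by_cases h' : deg i.1 ≤ α <;> simp [h']
  map_smul' c f := by funext i; by_cases h' : deg i.1 ≤ α <;> simp [h']

/-- For a 2-parameter persistence module given by spaces `V` and structure maps `φ`, the
subspace `im ᴹφ_{α−e₁}^α + im ᴹφ_{α−e₂}^α` of `V α`, with the convention that a summand is
`0` when `α − eᵢ` leaves `ℕ²`.  (`dim (V α / imSum α)` is the 0-th Betti number `β₀(α)`.) -/
def imSum (F : Type*) [Field F] (V : ℕ × ℕ → Type*) [∀ a, AddCommGroup (V a)]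
    [∀ a, Module F (V a)] (φ : ∀ a b : ℕ × ℕ, a ≤ b → (V a →ₗ[F] V b)) (α : ℕ × ℕ) :
    Submodule F (V α) :=
  (if 0 < α.1 then
      LinearMap.range (φ (α.1 - 1, α.2) α (by simp [Prod.le_def])) else ⊥) ⊔
  (if 0 < α.2 then
      LinearMap.range (φ (α.1, α.2 - 1) α (by simp [Prod.le_def])) else ⊥)

lemma le_add_e1 (α : ℕ × ℕ) : α ≤ α + (1, 0) := by simp [Prod.le_def]

lemma le_add_e2 (α : ℕ × ℕ) : α ≤ α + (0, 1) := by simp [Prod.le_def]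

/-- Rank-nullity for the restriction of `f` to a submodule containing its kernel. -/
lemma finrank_map_add_finrank_ker_of_le {F W V : Type*} [Field F] [AddCommGroup W] [Module F W]
    [FiniteDimensional F W] [AddCommGroup V] [Module F V] (f : W →ₗ[F] V) (S : Submodule F W)
    (h : LinearMap.ker f ≤ S) :
    Module.finrank F (S.map f) + Module.finrank F (LinearMap.ker f) = Module.finrank F S := by
  have h1 := (f.domRestrict S).finrank_range_add_finrank_ker
  rw [LinearMap.range_domRestrict, LinearMap.ker_domRestrict] at h1
  rwa [(Submodule.comapSubtypeEquivOfLe h).finrank_eq] at h1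

lemma imSum_add_one_one (F : Type*) [Field F] (V : ℕ × ℕ → Type*) [∀ a, AddCommGroup (V a)]
    [∀ a, Module F (V a)] (φ : ∀ a b : ℕ × ℕ, a ≤ b → (V a →ₗ[F] V b)) (α : ℕ × ℕ)
    (h₁ : α + (1, 0) ≤ α + (1, 1)) (h₂ : α + (0, 1) ≤ α + (1, 1)) :
    imSum F V φ (α + (1, 1)) =
      LinearMap.range (φ (α + (1, 0)) (α + (1, 1)) h₁) ⊔
        LinearMap.range (φ (α + (0, 1)) (α + (1, 1)) h₂) := by
  obtain ⟨a, b⟩ := α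
  rw [sup_comm]
  unfold imSum
  have ha : 0 < ((a, b) + (1, 1) : ℕ × ℕ).1 := a.succ_pos
  have hb : 0 < ((a, b) + (1, 1) : ℕ × ℕ).2 := b.succ_pos
  rw [if_pos ha, if_pos hb]
  rfl

section FreeMod

variable {F : Type*} [Field F] {ι : Type*} {deg : ι → ℕ × ℕ}

lemma freeMap_injective {a b : ℕ × ℕ} (h : a ≤ b) :
    Function.Injective (freeMap F ι deg a b h) := by
  intro f g hfg
  funext i
  have := congrFun hfg ⟨i.1, i.2.trans h⟩
  simpa [freeMap, i.2] using this

lemma freeMap_freeMap {a b c : ℕ × ℕ} (hab : a ≤ b) (hbc : b ≤ c) (x : FreeMod F ι deg a) :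
    freeMap F ι deg b c hbc (freeMap F ι deg a b hab x) =
      freeMap F ι deg a c (hab.trans hbc) x := by
  funext i
  by_cases ha : deg i.1 ≤ a
  · simp [freeMap, ha, ha.trans hab]
  · simp [freeMap, ha]

lemma mem_range_freeMap {a b : ℕ × ℕ} (h : a ≤ b) (x : FreeMod F ι deg b) :
    x ∈ LinearMap.range (freeMap F ι deg a b h) ↔ ∀ i, ¬ deg i.1 ≤ a → x i = 0 := by
  constructor
  · rintro ⟨f, rfl⟩ i hi
    simp [freeMap, hi]
  · intro hx
    refine ⟨fun i => x ⟨i.1, i.2.trans h⟩, ?_⟩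
    funext i
    by_cases hi : deg i.1 ≤ a
    · simp [freeMap, hi]
    · simp [freeMap, hi, hx i hi]

lemma range_freeMap_inf_range_freeMap {a b c e : ℕ × ℕ} (hb : b ≤ e) (hc : c ≤ e) (ha : a ≤ e)
    (hinf : b ⊓ c = a) :
    LinearMap.range (freeMap F ι deg b e hb) ⊓ LinearMap.range (freeMap F ι deg c e hc) =
      LinearMap.range (freeMap F ι deg a e ha) := by
  ext x
  simp only [Submodule.mem_inf, mem_range_freeMap, ← hinf, le_inf_iff]
  grind

lemma finrank_map_freeMap {a b : ℕ × ℕ} (h : a ≤ b) (S : Submodule F (FreeMod F ι deg a)) :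
    Module.finrank F (S.map (freeMap F ι deg a b h)) = Module.finrank F S :=
  (Submodule.equivMapOfInjective _ (freeMap_injective h) S).finrank_eq.symm

lemma finrank_range_freeMap {a b : ℕ × ℕ} (h : a ≤ b) :
    Module.finrank F (LinearMap.range (freeMap F ι deg a b h)) =
      Module.finrank F (FreeMod F ι deg a) :=
  LinearMap.finrank_range_of_inj (freeMap_injective h)

lemma finrank_imSum_freeMap [Fintype ι] (α : ℕ × ℕ) :
    Module.finrank F (imSum F (FreeMod F ι deg) (freeMap F ι deg) (α + (1, 1))) +
        Module.finrank F (FreeMod F ι deg α) =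
      Module.finrank F (FreeMod F ι deg (α + (1, 0))) +
        Module.finrank F (FreeMod F ι deg (α + (0, 1))) := by
  have h₁ : α + (1, 0) ≤ α + (1, 1) := by simp [Prod.le_def]
  have h₂ : α + (0, 1) ≤ α + (1, 1) := by simp [Prod.le_def]
  have h₃ : α ≤ α + (1, 1) := by simp
  have h := Submodule.finrank_sup_add_finrank_inf_eq
    (LinearMap.range (freeMap F ι deg _ _ h₁)) (LinearMap.range (freeMap F ι deg _ _ h₂))
  rw [range_freeMap_inf_range_freeMap h₁ h₂ h₃ (by ext <;> simp)] at h
  simp only [finrank_range_freeMap] at h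
  rwa [imSum_add_one_one F _ _ α h₁ h₂]

lemma finrank_freeMod [Fintype ι] (α : ℕ × ℕ) :
    Module.finrank F (FreeMod F ι deg α) = ∑ i, if deg i ≤ α then 1 else 0 := by
  rw [Module.finrank_fintype_fun_eq_card, Fintype.card_subtype, Finset.card_filter]

lemma card_deg_eq_add_finrank_imSum [Fintype ι] (α : ℕ × ℕ) :
    (Finset.univ.filter (fun i : ι => deg i = α + (1, 1))).card +
        Module.finrank F (imSum F (FreeMod F ι deg) (freeMap F ι deg) (α + (1, 1))) =
      Module.finrank F (FreeMod F ι deg (α + (1, 1))) := by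
  have h := finrank_imSum_freeMap (F := F) (deg := deg) α
  have hcount : (Finset.univ.filter (fun i : ι => deg i = α + (1, 1))).card +
      (Module.finrank F (FreeMod F ι deg (α + (1, 0))) +
        Module.finrank F (FreeMod F ι deg (α + (0, 1)))) =
      Module.finrank F (FreeMod F ι deg (α + (1, 1))) + Module.finrank F (FreeMod F ι deg α) := by
    simp only [finrank_freeMod, Finset.card_filter, ← Finset.sum_add_distrib]
    refine Finset.sum_congr rfl fun i _ => ?_
    simp only [Prod.le_def, Prod.ext_iff, Prod.fst_add, Prod.snd_add]
    split_ifs <;> omega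
  omega

end FreeMod

/-- Two lifts of kernels along the two coordinate directions meet in the lift of the preimage of
the elements killed by both structure maps. -/
lemma map_ker_inf_map_ker {F : Type*} [Field F] {V : ℕ × ℕ → Type*} [∀ a, AddCommGroup (V a)]
    [∀ a, Module F (V a)] {φ : ∀ a b : ℕ × ℕ, a ≤ b → (V a →ₗ[F] V b)}
    {ι : Type*} {deg : ι → ℕ × ℕ} {γ : ∀ α : ℕ × ℕ, FreeMod F ι deg α →ₗ[F] V α}
    (hγ : ∀ (a b : ℕ × ℕ) (h : a ≤ b) (x : FreeMod F ι deg a),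
      γ b (freeMap F ι deg a b h x) = φ a b h (γ a x))
    {a b c e : ℕ × ℕ} (hab : a ≤ b) (hac : a ≤ c) (hb : b ≤ e) (hc : c ≤ e)
    (hinf : b ⊓ c = a) :
    (LinearMap.ker (γ b)).map (freeMap F ι deg b e hb) ⊓
        (LinearMap.ker (γ c)).map (freeMap F ι deg c e hc) =
      ((LinearMap.ker (φ a b hab) ⊓ LinearMap.ker (φ a c hac)).comap (γ a)).map
        (freeMap F ι deg a e (hab.trans hb)) := by
  ext y
  constructor
  · rintro ⟨⟨f, hf, rfl⟩, g, hg, hgf⟩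
    have hy : freeMap F ι deg b e hb f ∈ LinearMap.range (freeMap F ι deg a e (hab.trans hb)) := by
      rw [← range_freeMap_inf_range_freeMap hb hc (hab.trans hb) hinf]
      exact ⟨⟨f, rfl⟩, g, hgf⟩
    obtain ⟨x, hx⟩ := hy
    have hxf : freeMap F ι deg a b hab x = f :=
      freeMap_injective hb (by rw [freeMap_freeMap, hx])
    have hxg : freeMap F ι deg a c hac x = g :=
      freeMap_injective hc (by rw [freeMap_freeMap, hx, hgf])
    refine ⟨x, ⟨?_, ?_⟩, hx⟩
    · change φ a b hab (γ a x) = 0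
      rw [← hγ, hxf]
      exact hf
    · change φ a c hac (γ a x) = 0
      rw [← hγ, hxg]
      exact hg
  · rintro ⟨x, ⟨hx₁, hx₂⟩, rfl⟩
    refine ⟨⟨freeMap F ι deg a b hab x, ?_, freeMap_freeMap ..⟩,
      freeMap F ι deg a c hac x, ?_, freeMap_freeMap ..⟩
    · exact (hγ a b hab x).trans hx₁
    · exact (hγ a c hac x).trans hx₂

lemma map_range_of_comm {F : Type*} [Field F] {V W : ℕ × ℕ → Type*} [∀ a, AddCommGroup (V a)]
    [∀ a, Module F (V a)] [∀ a, AddCommGroup (W a)] [∀ a, Module F (W a)]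
    {φ : ∀ a b : ℕ × ℕ, a ≤ b → (V a →ₗ[F] V b)} {ψ : ∀ a b : ℕ × ℕ, a ≤ b → (W a →ₗ[F] W b)}
    {f : ∀ a, W a →ₗ[F] V a}
    (hf : ∀ (a b : ℕ × ℕ) (h : a ≤ b) (x : W a), f b (ψ a b h x) = φ a b h (f a x))
    {a b : ℕ × ℕ} (h : a ≤ b) :
    (LinearMap.range (ψ a b h)).map (f b) = (LinearMap.range (f a)).map (φ a b h) := by
  rw [← LinearMap.range_comp, ← LinearMap.range_comp]
  congr 1
  ext x
  exact hf a b h x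

/-- Let `M` be a finitely presented 2-parameter persistence module with
(the beginning of) a minimal free resolution `F₁ →d F₀ →γ M → 0` (each `Fⱼ` a finitely
generated free module, `γ` surjective, `im d = ker γ`, and minimality:
`ker γ ⊆ m·F₀`, `ker d ⊆ m·F₁`, so that the generator degrees of `Fⱼ` realize the bigraded
Betti numbers `m_{j,·}`). With
`z_α = dim {w ∈ M_α : ᴹφ_α^{α+e₁} w = 0 and ᴹφ_α^{α+e₂} w = 0}` and
`m_{0,β} = dim (M_β / (im ᴹφ_{β−e₁}^β + im ᴹφ_{β−e₂}^β))`, one has, for every `α ∈ ℕ²`,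
`m_{1,α+e₁+e₂} = m_{0,α+e₁+e₂} − dim M_{α+e₁+e₂} + dim M_{α+e₁} + dim M_{α+e₂} − dim M_α + z_α`. -/
theorem betti_one_formula (F : Type*) [Field F]
    (V : ℕ × ℕ → Type*) [∀ a, AddCommGroup (V a)] [∀ a, Module F (V a)]
    [∀ a, FiniteDimensional F (V a)]
    (φ : ∀ a b : ℕ × ℕ, a ≤ b → (V a →ₗ[F] V b))
    (hid : ∀ (a : ℕ × ℕ) (x : V a), φ a a le_rfl x = x)
    (hcomp : ∀ (a b c : ℕ × ℕ) (hab : a ≤ b) (hbc : b ≤ c) (x : V a),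
      φ b c hbc (φ a b hab x) = φ a c (le_trans hab hbc) x)
    (ι₀ : Type*) [Fintype ι₀] (deg₀ : ι₀ → ℕ × ℕ)
    (ι₁ : Type*) [Fintype ι₁] [DecidableEq ι₁] (deg₁ : ι₁ → ℕ × ℕ)
    (γ : ∀ α : ℕ × ℕ, FreeMod F ι₀ deg₀ α →ₗ[F] V α)
    (d : ∀ α : ℕ × ℕ, FreeMod F ι₁ deg₁ α →ₗ[F] FreeMod F ι₀ deg₀ α)
    (hγsurj : ∀ α, Function.Surjective (γ α))
    (hγcomm : ∀ (a b : ℕ × ℕ) (h : a ≤ b) (x : FreeMod F ι₀ deg₀ a),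
      γ b (freeMap F ι₀ deg₀ a b h x) = φ a b h (γ a x))
    (hdcomm : ∀ (a b : ℕ × ℕ) (h : a ≤ b) (x : FreeMod F ι₁ deg₁ a),
      d b (freeMap F ι₁ deg₁ a b h x) = freeMap F ι₀ deg₀ a b h (d a x))
    (hexact : ∀ α, LinearMap.range (d α) = LinearMap.ker (γ α))
    (hmin₀ : ∀ α, LinearMap.ker (γ α) ≤ imSum F (FreeMod F ι₀ deg₀) (freeMap F ι₀ deg₀) α)
    (hmin₁ : ∀ α, LinearMap.ker (d α) ≤ imSum F (FreeMod F ι₁ deg₁) (freeMap F ι₁ deg₁) α)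
    (α : ℕ × ℕ) :
    ((Finset.univ.filter (fun i : ι₁ => deg₁ i = α + (1, 1))).card : ℤ) =
      (Module.finrank F (V (α + (1, 1)) ⧸ imSum F V φ (α + (1, 1))) : ℤ) -
        Module.finrank F (V (α + (1, 1))) +
        Module.finrank F (V (α + (1, 0))) +
        Module.finrank F (V (α + (0, 1))) -
        Module.finrank F (V α) +
        Module.finrank F
          ↥(LinearMap.ker (φ α (α + (1, 0)) (le_add_e1 α)) ⊓
            LinearMap.ker (φ α (α + (0, 1)) (le_add_e2 α))) := by
  have h₁ : α + (1, 0) ≤ α + (1, 1) := by simp [Prod.le_def]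
  have h₂ : α + (0, 1) ≤ α + (1, 1) := by simp [Prod.le_def]
  have hinf : (α + (1, 0)) ⊓ (α + (0, 1)) = α := by ext <;> simp
  have hγrank : ∀ β, Module.finrank F (V β) + Module.finrank F (LinearMap.ker (γ β)) =
      Module.finrank F (FreeMod F ι₀ deg₀ β) := fun β => by
    rw [← (γ β).finrank_range_add_finrank_ker, LinearMap.range_eq_top.2 (hγsurj β), finrank_top]
  have hdmap : (imSum F (FreeMod F ι₁ deg₁) (freeMap F ι₁ deg₁) (α + (1, 1))).map
        (d (α + (1, 1))) =
      (LinearMap.ker (γ _)).map (freeMap F ι₀ deg₀ _ _ h₁) ⊔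
        (LinearMap.ker (γ _)).map (freeMap F ι₀ deg₀ _ _ h₂) := by
    rw [imSum_add_one_one F _ _ α h₁ h₂, Submodule.map_sup, map_range_of_comm hdcomm h₁,
      map_range_of_comm hdcomm h₂, hexact, hexact]
  have hγmap : (imSum F (FreeMod F ι₀ deg₀) (freeMap F ι₀ deg₀) (α + (1, 1))).map
      (γ (α + (1, 1))) = imSum F V φ (α + (1, 1)) := by
    rw [imSum_add_one_one F _ _ α h₁ h₂, Submodule.map_sup, map_range_of_comm hγcomm h₁,
      map_range_of_comm hγcomm h₂, imSum_add_one_one F _ _ α h₁ h₂,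
      LinearMap.range_eq_top.2 (hγsurj _), LinearMap.range_eq_top.2 (hγsurj _),
      Submodule.map_top, Submodule.map_top]
  have hd := finrank_map_add_finrank_ker_of_le (d _) _ (hmin₁ (α + (1, 1)))
  have hγ := finrank_map_add_finrank_ker_of_le (γ _) _ (hmin₀ (α + (1, 1)))
  have hdrank := (d (α + (1, 1))).finrank_range_add_finrank_ker
  have hsup := Submodule.finrank_sup_add_finrank_inf_eq
    ((LinearMap.ker (γ _)).map (freeMap F ι₀ deg₀ _ _ h₁))
    ((LinearMap.ker (γ _)).map (freeMap F ι₀ deg₀ _ _ h₂))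
  have hz := finrank_map_add_finrank_ker_of_le (γ α)
    ((LinearMap.ker (φ α (α + (1, 0)) (le_add_e1 α)) ⊓
      LinearMap.ker (φ α (α + (0, 1)) (le_add_e2 α))).comap (γ α)) (LinearMap.ker_le_comap _)
  rw [Submodule.map_comap_eq_of_surjective (hγsurj α)] at hz
  rw [map_ker_inf_map_ker hγcomm (le_add_e1 α) (le_add_e2 α) h₁ h₂ hinf,
    finrank_map_freeMap, finrank_map_freeMap, finrank_map_freeMap] at hsup
  rw [hdmap] at hd
  rw [hγmap] at hγ
  rw [hexact] at hdrank
  have hcard := card_deg_eq_add_finrank_imSum (F := F) (deg := deg₁) α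
  have hquot := (imSum F V φ (α + (1, 1))).finrank_quotient_add_finrank
  have himSum := finrank_imSum_freeMap (F := F) (deg := deg₀) α
  have hr := hγrank α
  have hr₁ := hγrank (α + (1, 0))
  have hr₂ := hγrank (α + (0, 1))
  have hr₃ := hγrank (α + (1, 1))
  omega
end
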